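/- arXiv:2002.12072 — 2 statements merged into one kernel-verified Lean document; each statement's English description precedes it below -/
import Mathlib

section
/- Let p be an odd prime and let a, b be p-integers with ab ≢ 0 (mod p), ⟨b⟩_p ≤ p − 1 − ⟨a⟩_p and ⟨b⟩_p ≤ ⟨a⟩_p. Set t = (a − ⟨a⟩_p)/p and s = (b − ⟨b⟩_p)/p, and assume s ≢ −1 (mod p). Then Σ_{k=0}^{p−1} C(a,k)·C(−1−a,k)/(k + b) ≡ p·(s + t + 1)·(s − t) / ( b²·(s + 1)·C(⟨a⟩_p, ⟨b⟩_p)·C(p − 1 − ⟨a⟩_p, ⟨b⟩_p) ) (mod p²). -/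
/-- A rational number is a `p`-integer if its denominator (in lowest terms)
is not divisible by `p`. -/
def isPInt (p : ℕ) (x : ℚ) : Prop := ¬ p ∣ x.den

/-- For `p`-integers `u, v`, `u ≡ v (mod p^k)` means `(u - v)/p^k` is a `p`-integer. -/
def pCong (p k : ℕ) (u v : ℚ) : Prop := isPInt p ((u - v) / (p : ℚ) ^ k)

/-- The generalized binomial coefficient `C(a, k) = a(a-1)⋯(a-k+1)/k!`. -/
def rchoose (a : ℚ) (k : ℕ) : ℚ := (∏ i ∈ Finset.range k, (a - i)) / (k.factorial : ℚ)

/-- The ring of `p`-integers, i.e. the localization of `ℤ` at `p` inside `ℚ`. -/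
def pIntegers (p : ℕ) (hp : p.Prime) : Subring ℚ where
  carrier := {x | isPInt p x}
  mul_mem' {x y} hx hy h :=
    (hp.dvd_mul.1 (h.trans (Rat.mul_den_dvd x y))).elim hx hy
  one_mem' h := hp.one_lt.ne' (Nat.dvd_one.1 h)
  add_mem' {x y} hx hy h :=
    (hp.dvd_mul.1 (h.trans (Rat.add_den_dvd x y))).elim hx hy
  zero_mem' h := hp.one_lt.ne' (Nat.dvd_one.1 h)
  neg_mem' {x} hx h := hx (by simpa using h)

section pIntegers

variable {p : ℕ} {hp : p.Prime}

theorem intCast_div_notMem {n : ℤ} (hn : ¬ (p : ℤ) ∣ n) :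
    (n : ℚ) / p ∉ pIntegers p hp := by
  intro h
  have hp0 : (p : ℚ) ≠ 0 := by exact_mod_cast hp.ne_zero
  set q : ℚ := (n : ℚ) / p with hq
  have h1 : (n : ℚ) * q.den = p * q.num := by
    have h2 : q * q.den = q.num := Rat.mul_den_eq_num q
    have h3 : (n : ℚ) = p * q := by rw [hq]; field_simp
    rw [h3, mul_assoc, h2]
  have h4 : n * q.den = p * q.num := by exact_mod_cast h1
  rcases (Nat.prime_iff_prime_int.1 hp).dvd_or_dvd (Dvd.intro _ h4.symm) with h5 | h5
  · exact hn h5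
  · exact h (by exact_mod_cast h5)

theorem inv_mem_of_div_notMem {x : ℚ} (hx : x ∈ pIntegers p hp)
    (h : x / p ∉ pIntegers p hp) : x ≠ 0 ∧ x⁻¹ ∈ pIntegers p hp := by
  have hp0 : (p : ℚ) ≠ 0 := by exact_mod_cast hp.ne_zero
  have hx0 : x ≠ 0 := by
    rintro rfl
    exact h (by simp)
  refine ⟨hx0, fun hd => h ?_⟩
  have h1 : p ∣ x.num.natAbs := by
    have h2 : x⁻¹.den = x.num.natAbs := by
      rw [Rat.den_inv_of_ne_zero hx0]
    rwa [h2] at hd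
  obtain ⟨m, hm⟩ := Int.natCast_dvd.2 h1
  have h3 : (x.den : ℚ)⁻¹ ∈ pIntegers p hp := by
    intro h4
    rw [Rat.inv_natCast_den_of_pos x.den_pos] at h4
    exact hx h4
  have h5 : x / p = m * (x.den : ℚ)⁻¹ := by
    conv_lhs => rw [← Rat.num_div_den x, hm]
    push_cast
    field_simp
  rw [h5]
  exact mul_mem (intCast_mem _ m) h3

theorem inv_mem_of_eq_intCast_add {x w : ℚ} {n : ℤ} (hw : w ∈ pIntegers p hp)
    (hx : x = n + p * w) (hn : ¬ (p : ℤ) ∣ n) : x ≠ 0 ∧ x⁻¹ ∈ pIntegers p hp := by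
  have hp0 : (p : ℚ) ≠ 0 := by exact_mod_cast hp.ne_zero
  refine inv_mem_of_div_notMem ?_ fun h => intCast_div_notMem (hp := hp) hn ?_
  · rw [hx]
    exact add_mem (intCast_mem _ n) (mul_mem (natCast_mem _ p) hw)
  · have : (n : ℚ) / p = x / p - w := by rw [hx]; field_simp; ring
    rw [this]
    exact sub_mem h hw

theorem inv_natCast_mem {n : ℕ} (hn : ¬ p ∣ n) :
    (n : ℚ) ≠ 0 ∧ (n : ℚ)⁻¹ ∈ pIntegers p hp :=
  inv_mem_of_eq_intCast_add (n := n) (zero_mem _) (by simp) (by exact_mod_cast hn)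

theorem inv_choose_mem {n k : ℕ} (hk : k ≤ n) (hn : n < p) :
    (n.choose k : ℚ) ≠ 0 ∧ (n.choose k : ℚ)⁻¹ ∈ pIntegers p hp := by
  refine inv_natCast_mem fun h => ?_
  have h2 : p ∣ n.factorial := by
    rw [← Nat.choose_mul_factorial_mul_factorial hk, mul_assoc]
    exact Dvd.dvd.mul_right h _
  rw [hp.dvd_factorial] at h2
  omega

theorem rchoose_mem {a : ℚ} (ha : a ∈ pIntegers p hp) {k : ℕ} (hk : k < p) :
    rchoose a k ∈ pIntegers p hp := by
  rw [rchoose, div_eq_mul_inv]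
  refine mul_mem (prod_mem fun i _ => sub_mem ha (natCast_mem _ i)) (inv_natCast_mem ?_).2
  rw [hp.dvd_factorial]
  omega

theorem exists_prod_eq_prod_add {ι : Type*} (S : Finset ι) (u v : ι → ℚ)
    (hv : ∀ i ∈ S, v i ∈ pIntegers p hp)
    (h : ∀ i ∈ S, ∃ w ∈ pIntegers p hp, u i = v i + p * w) :
    ∃ w ∈ pIntegers p hp, ∏ i ∈ S, u i = ∏ i ∈ S, v i + p * w := by
  classical
  induction S using Finset.induction_on with
  | empty => exact ⟨0, zero_mem _, by simp⟩
  | insert i S hi ih =>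
    obtain ⟨w, hw, hw'⟩ := ih (fun j hj => hv j (Finset.mem_insert_of_mem hj))
      fun j hj => h j (Finset.mem_insert_of_mem hj)
    obtain ⟨z, hz, hz'⟩ := h i (Finset.mem_insert_self i S)
    have hvi := hv i (Finset.mem_insert_self i S)
    have hvS : ∏ j ∈ S, v j ∈ pIntegers p hp :=
      prod_mem fun j hj => hv j (Finset.mem_insert_of_mem hj)
    refine ⟨v i * w + z * ∏ j ∈ S, v j + p * (z * w), ?_, ?_⟩
    · exact add_mem (add_mem (mul_mem hvi hw) (mul_mem hz hvS))
        (mul_mem (natCast_mem _ p) (mul_mem hz hw))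
    · rw [Finset.prod_insert hi, Finset.prod_insert hi, hw', hz']
      ring

end pIntegers

theorem dvd_prod_erase_sub_sub_factorial {p : ℕ} (hp : p.Prime) {A : ℕ} (hA : A < p) :
    (p : ℤ) ∣ (∏ i ∈ (Finset.range p).erase A, ((A : ℤ) - i)) - ((p - 1).factorial : ℤ) := by
  have := Fact.mk hp
  rw [← ZMod.intCast_zmod_eq_zero_iff_dvd]
  push_cast
  rw [ZMod.wilsons_lemma, sub_eq_zero]
  have hunits : ∏ u : (ZMod p)ˣ, (u : ZMod p) = -1 := by
    have h := congrArg Units.val (FiniteField.prod_univ_units_id_eq_neg_one (K := ZMod p))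
    rwa [Units.coe_prod, Units.val_neg, Units.val_one] at h
  rw [← hunits]
  symm
  have hlt : ∀ u : ZMod p, u.val < p := fun u => ZMod.val_lt u
  refine Finset.prod_bij (fun u _ => ((A : ZMod p) - u).val) ?_ ?_ ?_ ?_
  · intro u _
    refine Finset.mem_erase.2 ⟨fun h => u.ne_zero ?_, Finset.mem_range.2 (hlt _)⟩
    have h1 : (((A : ZMod p) - u).val : ZMod p) = A := by rw [h]
    rw [ZMod.natCast_zmod_val] at h1
    simp at h1
  · intro u _ v _ h
    exact Units.ext (sub_right_injective (ZMod.val_injective p h))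
  · intro i hi
    obtain ⟨hiA, hip⟩ := Finset.mem_erase.1 hi
    have hip := Finset.mem_range.1 hip
    have hne : (A : ZMod p) - i ≠ 0 := by
      rw [sub_ne_zero]
      intro h
      rw [ZMod.natCast_eq_natCast_iff', Nat.mod_eq_of_lt hA, Nat.mod_eq_of_lt hip] at h
      exact hiA h.symm
    refine ⟨Units.mk0 _ hne, Finset.mem_univ _, ?_⟩
    simp [ZMod.val_natCast, Nat.mod_eq_of_lt hip]
  · intro u _
    simp

/-- Modulo `p`, the binomial coefficient `C(A + p t, p)` is `t` when `0 ≤ A < p`. -/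
theorem rchoose_prime_eq {p : ℕ} {hp : p.Prime} {A : ℕ} (hA : A < p) {t : ℚ}
    (ht : t ∈ pIntegers p hp) :
    ∃ z ∈ pIntegers p hp, rchoose (A + p * t) p = t + p * z := by
  have hp0 : (p : ℚ) ≠ 0 := by exact_mod_cast hp.ne_zero
  obtain ⟨m, hm⟩ := dvd_prod_erase_sub_sub_factorial hp hA
  obtain ⟨w, hw, hw'⟩ := exists_prod_eq_prod_add (hp := hp) ((Finset.range p).erase A)
    (fun i => (A : ℚ) + p * t - i) (fun i => (A : ℚ) - i)
    (fun i _ => sub_mem (natCast_mem _ A) (natCast_mem _ i))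
    (fun i _ => ⟨t, ht, by ring⟩)
  have hm' : ∏ i ∈ (Finset.range p).erase A, ((A : ℚ) - i) = ((p - 1).factorial : ℚ) + p * m := by
    have h : (((∏ i ∈ (Finset.range p).erase A, ((A : ℤ) - i)) - ((p - 1).factorial : ℤ) : ℤ) : ℚ)
        = ((p * m : ℤ) : ℚ) := by rw [hm]
    push_cast at h
    linarith
  obtain ⟨hF0, hF⟩ := inv_natCast_mem (p := p) (hp := hp) (n := (p - 1).factorial) (by
    rw [hp.dvd_factorial]
    have := hp.pos
    omega)
  have hfac : (p.factorial : ℚ) = p * (p - 1).factorial := by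
    exact_mod_cast (Nat.mul_factorial_pred hp.ne_zero).symm
  refine ⟨t * (m + w) * ((p - 1).factorial : ℚ)⁻¹,
    mul_mem (mul_mem ht (add_mem (intCast_mem _ m) hw)) hF, ?_⟩
  rw [rchoose, ← Finset.mul_prod_erase _ _ (Finset.mem_range.2 hA), hw', hm', hfac]
  field_simp
  ring

theorem rchoose_succ (a : ℚ) (k : ℕ) : rchoose a (k + 1) = rchoose a k * (a - k) / (k + 1) := by
  have : ((k.factorial : ℕ) : ℚ) ≠ 0 := by exact_mod_cast k.factorial_ne_zero
  have h : (k : ℚ) + 1 ≠ 0 := by positivity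
  rw [rchoose, rchoose, Finset.prod_range_succ, Nat.factorial_succ]
  push_cast
  field_simp

/-- The contiguous relation in `b` for the truncated hypergeometric sum. -/
theorem sum_rchoose_contiguous (a b : ℚ) (n : ℕ) (h : ∀ k : ℕ, 1 ≤ k → k ≤ n → (k : ℚ) + b ≠ 0) :
    b ^ 2 * (∑ k ∈ Finset.range n, rchoose a k * rchoose (-1 - a) k / ((k : ℚ) + b))
      + n ^ 2 * (rchoose a n * rchoose (-1 - a) n) / (n + b)
    = (b - a) * (b + a + 1) *
      ∑ k ∈ Finset.range n, rchoose a k * rchoose (-1 - a) k / ((k : ℚ) + (b + 1)) := by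
  induction n with
  | zero => simp
  | succ n ih =>
    have ih := ih fun k h1 h2 => h k h1 (by omega)
    have h1 : (n : ℚ) + 1 + b ≠ 0 := by exact_mod_cast h (n + 1) (by omega) le_rfl
    have h1' : (n : ℚ) + (b + 1) ≠ 0 := by
      convert h1 using 1
      ring
    have h2 : (n : ℚ) + 1 ≠ 0 := by positivity
    rw [Finset.sum_range_succ, Finset.sum_range_succ, mul_add, mul_add, ← ih]
    rw [rchoose_succ, rchoose_succ]
    set f := rchoose a n * rchoose (-1 - a) n with hf
    have h3 : b ^ 2 * (f / (n + b)) = n ^ 2 * f / (n + b) + (b - n) * f := by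
      by_cases hnb : (n : ℚ) + b = 0
      · rcases Nat.eq_zero_or_pos n with rfl | hn
        · have : b = 0 := by simpa using hnb
          simp [this]
        · exact absurd hnb (h n hn (by omega))
      · field_simp
        ring
    have h4 : ((n + 1 : ℕ) : ℚ) ^ 2 * (rchoose a n * (a - n) / (n + 1) *
        (rchoose (-1 - a) n * (-1 - a - n) / (n + 1))) / ((n + 1 : ℕ) + b)
        = f * (a - n) * (-1 - a - n) / (n + (b + 1)) := by
      rw [hf]
      push_cast
      rw [show (n : ℚ) + 1 + b = n + (b + 1) by ring]
      field_simp
    rw [h3, h4]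
    field_simp
    ring

/-- The sum of the theorem times `b ^ 2`, completed by the boundary term of the contiguous
relation, so that the recursion in `b` also starts at `b ≡ 0 (mod p)`. -/
def completedSum (p : ℕ) (a b : ℚ) : ℚ :=
  b ^ 2 * (∑ k ∈ Finset.range p, rchoose a k * rchoose (-1 - a) k / ((k : ℚ) + b))
    + p ^ 2 * (rchoose a p * rchoose (-1 - a) p) / (p + b)

section completedSum

variable {p : ℕ} {hp : p.Prime} {A : ℕ} {s t : ℚ}

theorem rchoose_mul_rchoose_prime_eq (hA : A < p) (ht : t ∈ pIntegers p hp) :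
    ∃ z ∈ pIntegers p hp, rchoose (A + p * t) p * rchoose (-1 - (A + p * t)) p
      = -(t * (t + 1)) + p * z := by
  obtain ⟨z, hz, h⟩ := rchoose_prime_eq hA ht
  obtain ⟨z', hz', h'⟩ := rchoose_prime_eq (A := p - 1 - A) (by omega)
    (sub_mem (neg_mem (one_mem _)) ht)
  have hc : ((p - 1 - A : ℕ) : ℚ) + p * (-1 - t) = -1 - (A + p * t) := by
    rw [Nat.sub_sub, Nat.cast_sub (by omega)]
    push_cast
    ring
  rw [hc] at h'
  refine ⟨t * z' + z * (-1 - t) + p * (z * z'), ?_, by rw [h, h']; ring⟩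
  exact add_mem (add_mem (mul_mem ht hz') (mul_mem hz (sub_mem (neg_mem (one_mem _)) ht)))
    (mul_mem (natCast_mem _ p) (mul_mem hz hz'))

theorem rchoose_mul_rchoose_prime_mem (hA : A < p) (ht : t ∈ pIntegers p hp) :
    rchoose (A + p * t) p * rchoose (-1 - (A + p * t)) p ∈ pIntegers p hp := by
  obtain ⟨z, hz, h⟩ := rchoose_mul_rchoose_prime_eq hA ht
  rw [h]
  exact add_mem (neg_mem (mul_mem ht (add_mem ht (one_mem _)))) (mul_mem (natCast_mem _ p) hz)

theorem exists_completedSum_eq (hA : A < p) (ht : t ∈ pIntegers p hp) (hs : s ∈ pIntegers p hp)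
    {B : ℕ} (hB : 1 ≤ B) (hBp : B < p) :
    ∃ g ∈ pIntegers p hp, completedSum p (A + p * t) (B + p * s) =
      (B + p * s) ^ 2 * (∑ k ∈ Finset.range p, rchoose (A + p * t) k *
        rchoose (-1 - (A + p * t)) k / ((k : ℚ) + (B + p * s))) + p ^ 2 * g := by
  obtain ⟨h0, h1⟩ := inv_mem_of_eq_intCast_add (p := p) (hp := hp)
    (x := (p : ℚ) + (B + p * s)) (w := 1 + s) (n := B) (add_mem (one_mem _) hs)
    (by push_cast; ring) (by
      intro h
      have := Nat.le_of_dvd hB (by exact_mod_cast h)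
      omega)
  refine ⟨_, mul_mem (rchoose_mul_rchoose_prime_mem hA ht) h1, ?_⟩
  rw [completedSum]
  ring

theorem natCast_add_ne_zero (hs : s ∈ pIntegers p hp) (hs1 : s + 1 ≠ 0) {B k : ℕ}
    (hB : B < p) (hk : 1 ≤ k) (hkp : k ≤ p) : (k : ℚ) + (B + p * s) ≠ 0 := by
  have hp0 : (p : ℚ) ≠ 0 := by exact_mod_cast hp.ne_zero
  by_cases h : p ∣ k + B
  · obtain ⟨c, hc⟩ := h
    have hc1 : c = 1 := by
      rcases c with _ | _ | c
      · omega
      · rfl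
      · nlinarith
    have hkB : (k : ℚ) + B = p := by exact_mod_cast (by rw [hc, hc1, mul_one] : k + B = p)
    rw [← add_assoc, hkB]
    intro h0
    exact mul_ne_zero hp0 hs1 (by linarith)
  · exact (inv_mem_of_eq_intCast_add (n := (k + B : ℕ)) hs (by push_cast; ring)
      (by exact_mod_cast h)).1

theorem completedSum_zero (hA : A < p) (ht : t ∈ pIntegers p hp) (hs : s ∈ pIntegers p hp)
    (hs1 : s + 1 ≠ 0) :
    ∃ w ∈ pIntegers p hp, completedSum p (A + p * t) (p * s) * (s + 1) =
      p * ((s + t + 1) * (s - t)) + p ^ 2 * w := by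
  have hp0 : (p : ℚ) ≠ 0 := by exact_mod_cast hp.ne_zero
  obtain ⟨z, hz, hf⟩ := rchoose_mul_rchoose_prime_eq hA ht
  set a : ℚ := A + p * t with ha
  have hamem : a ∈ pIntegers p hp := add_mem (natCast_mem _ A) (mul_mem (natCast_mem _ p) ht)
  obtain ⟨q, rfl⟩ : ∃ q, p = q + 1 := ⟨p - 1, by have := hp.pos; omega⟩
  set Y := ∑ k ∈ Finset.range q, rchoose a (k + 1) * rchoose (-1 - a) (k + 1) /
    (((k + 1 : ℕ) : ℚ) + ((q + 1 : ℕ) : ℚ) * s) with hY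
  have hYmem : Y ∈ pIntegers (q + 1) hp := by
    refine sum_mem fun k hk => ?_
    have hk := Finset.mem_range.1 hk
    rw [div_eq_mul_inv]
    refine mul_mem (mul_mem (rchoose_mem hamem (by omega))
      (rchoose_mem (sub_mem (neg_mem (one_mem _)) hamem) (by omega))) ?_
    refine (inv_mem_of_eq_intCast_add (n := (k + 1 : ℕ)) hs (by push_cast; ring) ?_).2
    intro h
    have := Nat.le_of_dvd (by omega) (by exact_mod_cast h : q + 1 ∣ k + 1)
    omega
  refine ⟨s ^ 2 * Y * (s + 1) + z, add_mem (mul_mem (mul_mem (pow_mem hs 2) hYmem)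
    (add_mem hs (one_mem _))) hz, ?_⟩
  rw [completedSum, hf, Finset.sum_range_succ', ← hY]
  have h0 : rchoose a 0 * rchoose (-1 - a) 0 = 1 := by simp [rchoose]
  rw [h0]
  set P : ℚ := ((q + 1 : ℕ) : ℚ) with hP
  have h1 : (P * s) ^ 2 * (1 / (((0 : ℕ) : ℚ) + P * s)) = P * s := by
    by_cases h : P * s = 0
    · simp [h]
    · rw [Nat.cast_zero, zero_add]
      field_simp
  rw [mul_add (_ ^ 2) Y, h1, show P + P * s = P * (s + 1) by ring]
  field_simp
  ring

theorem completedSum_eq (hA : A < p) (ht : t ∈ pIntegers p hp) (hs : s ∈ pIntegers p hp)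
    (hs1 : s + 1 ≠ 0) {B : ℕ} (hBA : B ≤ A) (hBA' : B ≤ p - 1 - A) :
    ∃ w ∈ pIntegers p hp, completedSum p (A + p * t) (B + p * s) * (s + 1) *
      (A.choose B * (p - 1 - A).choose B) = p * ((s + t + 1) * (s - t)) + p ^ 2 * w := by
  induction B with
  | zero => simpa using completedSum_zero hA ht hs hs1
  | succ B ih =>
    obtain ⟨w, hw, hw'⟩ := ih (by omega) (by omega)
    obtain ⟨g, hg, hg'⟩ := exists_completedSum_eq (B := B + 1) hA ht hs (by omega) (by omega)
    have hrec := sum_rchoose_contiguous (A + p * t) (B + p * s) p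
      fun k h1 h2 => natCast_add_ne_zero hs hs1 (by omega) h1 h2
    rw [← completedSum] at hrec
    rw [hg', show ((B + 1 : ℕ) : ℚ) + p * s = B + p * s + 1 by push_cast; ring]
    set T := ∑ k ∈ Finset.range p, rchoose (A + p * t) k *
        rchoose (-1 - (A + p * t)) k / ((k : ℚ) + (B + p * s + 1))
    set H := completedSum p (A + p * t) (B + p * s)
    obtain ⟨A', hA'⟩ : ∃ A', A' = p - 1 - A := ⟨_, rfl⟩
    rw [← hA'] at hw' hBA' ⊢
    have hpA : (p : ℚ) = A + A' + 1 := by exact_mod_cast (by omega : p = A + A' + 1)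
    have hchoose : ∀ n : ℕ, B + 1 ≤ n →
        (n.choose (B + 1) : ℚ) * (B + 1) = n.choose B * (n - B) := by
      intro n hn
      have h := Nat.choose_succ_right_eq n B
      rw [← Nat.cast_sub (by omega)]
      exact_mod_cast h
    have hC := hchoose A hBA
    have hC' := hchoose A' hBA'
    obtain ⟨hu0, hu⟩ := inv_choose_mem (hp := hp) (show B ≤ A by omega) hA
    obtain ⟨hu0', hu'⟩ := inv_choose_mem (hp := hp) (show B ≤ A' by omega) (by omega)
    have hnat : ∀ n : ℕ, (n : ℚ) ∈ pIntegers p hp := fun n => natCast_mem _ n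
    set E : ℚ := (B + p * s - (A + p * t)) * (B + p * s + (A + p * t) + 1) with hE
    set y : ℚ := (A' - B) * (t - s) + (B - A) * (s + t + 1) + p * ((s - t) * (s + t + 1)) with hy
    have hymem : y ∈ pIntegers p hp :=
      add_mem (add_mem (mul_mem (sub_mem (hnat _) (hnat _)) (sub_mem ht hs))
        (mul_mem (sub_mem (hnat _) (hnat _)) (add_mem (add_mem hs ht) (one_mem _))))
        (mul_mem (hnat _) (mul_mem (sub_mem hs ht) (add_mem (add_mem hs ht) (one_mem _))))
    have hEy : E = (A - B) * (A' - B) + p * y := by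
      rw [hE, hy, show (A' : ℚ) = p - 1 - A by linarith]
      ring
    obtain ⟨hE0, hEi⟩ := inv_mem_of_eq_intCast_add (p := p) (hp := hp) (x := E) (w := y)
      (n := ((A - B : ℕ) * (A' - B : ℕ) : ℕ)) hymem (by
        rw [hEy]; push_cast [Nat.cast_sub (show B ≤ A by omega), Nat.cast_sub (show B ≤ A' by omega)]
        ring) (by
        intro h
        rcases hp.dvd_mul.1 (by exact_mod_cast h) with h | h <;>
          exact absurd (Nat.le_of_dvd (by omega) h) (by omega))
    set C : ℚ := (A.choose B : ℚ)
    set C' : ℚ := (A'.choose B : ℚ)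
    set D : ℚ := (A.choose (B + 1) : ℚ)
    set D' : ℚ := (A'.choose (B + 1) : ℚ)
    have hCm : C ∈ pIntegers p hp := hnat _
    have hCm' : C' ∈ pIntegers p hp := hnat _
    have hDm : D ∈ pIntegers p hp := hnat _
    have hDm' : D' ∈ pIntegers p hp := hnat _
    set v : ℚ := (2 * (B + 1) * s + p * s ^ 2) * (D * D') - C * C' * y with hv
    have hvm : v ∈ pIntegers p hp := by
      refine sub_mem (mul_mem (add_mem (mul_mem (mul_mem (ofNat_mem _ 2)
        (add_mem (hnat _) (one_mem _))) hs) (mul_mem (hnat _) (pow_mem hs 2)))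
        (mul_mem hDm hDm')) (mul_mem (mul_mem hCm hCm') hymem)
    have hDD : (B + p * s + 1) ^ 2 * (D * D') = C * C' * E + p * v := by
      have : D * (B + 1) * (D' * (B + 1)) = C * (A - B) * (C' * (A' - B)) := by rw [hC, hC']
      rw [hv, hEy]
      linear_combination this
    set c : ℚ := (s + t + 1) * (s - t) with hc
    have hcm : c ∈ pIntegers p hp :=
      mul_mem (add_mem (add_mem hs ht) (one_mem _)) (sub_mem hs ht)
    have hT : T = H * E⁻¹ := by
      rw [hrec]
      field_simp
    have hH : H * (s + 1) = (p * c + p ^ 2 * w) * (C⁻¹ * C'⁻¹) := by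
      rw [← hw']
      field_simp
    refine ⟨w + v * E⁻¹ * ((c + p * w) * (C⁻¹ * C'⁻¹)) + g * (s + 1) * (D * D'), ?_, ?_⟩
    · exact add_mem (add_mem hw (mul_mem (mul_mem hvm hEi) (mul_mem (add_mem hcm
        (mul_mem (hnat _) hw)) (mul_mem hu hu')))) (mul_mem (mul_mem hg
        (add_mem hs (one_mem _))) (mul_mem hDm hDm'))
    · have hEE : E * E⁻¹ = 1 := mul_inv_cancel₀ hE0
      rw [hT]
      linear_combination (H * E⁻¹ * (s + 1)) * hDD + hw' + (p * v * E⁻¹) * hH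
        + (H * (s + 1) * C * C') * hEE

end completedSum

theorem stmt0 (p : ℕ) (hp : p.Prime) (hodd : Odd p) (a b : ℚ) (A B : ℕ)
    (ha : isPInt p a) (hb : isPInt p b)
    (hA : A < p) (hB : B < p)
    (haA : pCong p 1 a (A : ℚ)) (hbB : pCong p 1 b (B : ℚ))
    (hab : ¬ pCong p 1 (a * b) 0)
    (hB1 : B ≤ p - 1 - A) (hB2 : B ≤ A)
    (hs : ¬ pCong p 1 ((b - B) / p) (-1)) :
    pCong p 2
      (∑ k ∈ Finset.range p, rchoose a k * rchoose (-1 - a) k / ((k : ℚ) + b))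
      ((p : ℚ) * (((b - B) / p) + ((a - A) / p) + 1) * (((b - B) / p) - ((a - A) / p)) /
        (b ^ 2 * (((b - B) / p) + 1) * (A.choose B : ℚ) * ((p - 1 - A).choose B : ℚ))) := by
  have hp0 : (p : ℚ) ≠ 0 := by exact_mod_cast hp.ne_zero
  have ht : (a - A) / p ∈ pIntegers p hp := show isPInt _ _ by simpa [pCong] using haA
  have hsm : (b - B) / p ∈ pIntegers p hp := show isPInt _ _ by simpa [pCong] using hbB
  have hB0 : 1 ≤ B := by
    rcases Nat.eq_zero_or_pos B with rfl | h
    · refine absurd ?_ hab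
      have : a * ((b - (0 : ℕ)) / p) ∈ pIntegers p hp := mul_mem ha hsm
      change _ ∈ pIntegers p hp
      convert this using 1
      push_cast
      ring
    · exact h
  obtain ⟨t, ht'⟩ : ∃ t, t = (a - A) / p := ⟨_, rfl⟩
  obtain ⟨s, hs'⟩ : ∃ s, s = (b - B) / p := ⟨_, rfl⟩
  rw [← ht'] at ht ⊢
  rw [← hs'] at hsm hs ⊢
  obtain rfl : a = A + p * t := by rw [ht']; field_simp; ring
  obtain rfl : b = B + p * s := by rw [hs']; field_simp; ring
  obtain ⟨hs1, hsi⟩ := inv_mem_of_div_notMem (hp := hp) (x := s + 1)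
    (add_mem hsm (one_mem _)) (fun h => hs (by
      change _ ∈ pIntegers p hp
      simpa using h))
  have hBp : ¬ p ∣ B := fun h => by
    have := Nat.le_of_dvd hB0 h
    omega
  obtain ⟨hb0, hbi⟩ := inv_mem_of_eq_intCast_add (p := p) (hp := hp)
    (x := (B : ℚ) + p * s) (n := B) hsm (by push_cast; ring) (by exact_mod_cast hBp)
  obtain ⟨hC0, hCi⟩ := inv_choose_mem (hp := hp) hB2 hA
  obtain ⟨hC0', hCi'⟩ := inv_choose_mem (hp := hp) hB1 (by omega)
  obtain ⟨g, hg, hg'⟩ := exists_completedSum_eq hA ht hsm hB0 hB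
  obtain ⟨w, hw, hw'⟩ := completedSum_eq hA ht hsm hs1 hB2 hB1
  rw [hg'] at hw'
  set T := ∑ k ∈ Finset.range p, rchoose (A + p * t) k *
        rchoose (-1 - (A + p * t)) k / ((k : ℚ) + (B + p * s))
  set C : ℚ := (A.choose B : ℚ)
  set C' : ℚ := ((p - 1 - A).choose B : ℚ)
  have hCm : C * C' ∈ pIntegers p hp := mul_mem (natCast_mem _ _) (natCast_mem _ _)
  set b : ℚ := B + p * s
  have key : (w - g * (s + 1) * (C * C')) * ((b⁻¹) ^ 2 * (s + 1)⁻¹ * (C⁻¹ * C'⁻¹))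
      ∈ pIntegers p hp :=
    mul_mem (sub_mem hw (mul_mem (mul_mem hg (add_mem hsm (one_mem _))) hCm))
      (mul_mem (mul_mem (pow_mem hbi 2) hsi) (mul_mem hCi hCi'))
  change _ ∈ pIntegers p hp
  convert key using 1
  field_simp
  linear_combination hw'
end

section
/- Let p be a prime with p > 3, and let b be a p-integer with ⟨b⟩_p ≠ 0 and ⟨b⟩_p < p/2. Set s = (b − ⟨b⟩_p)/p and assume s ≢ −1 (mod p). Then Σ_{k=0}^{p−1} C(2k,k)² / (16^k (k + b)) ≡ p·(s + 1/2)² / ( b²·(s + 1)·C((p−1)/2, ⟨b⟩_p)² ) (mod p²). -/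
section Auxiliary

open Finset

open scoped Nat

/-! ### Arithmetic of `p`-integers -/

lemma isPInt_of_den_dvd {p : ℕ} {x : ℚ} {N : ℕ} (hN : ¬ p ∣ N) (h : x.den ∣ N) : isPInt p x :=
  fun hx => hN (hx.trans h)

namespace isPInt

variable {p : ℕ} {x y : ℚ}

lemma add [hp : Fact p.Prime] (hx : isPInt p x) (hy : isPInt p y) : isPInt p (x + y) :=
  isPInt_of_den_dvd (hp.out.not_dvd_mul hx hy) (Rat.add_den_dvd x y)

lemma mul [hp : Fact p.Prime] (hx : isPInt p x) (hy : isPInt p y) : isPInt p (x * y) :=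
  isPInt_of_den_dvd (hp.out.not_dvd_mul hx hy) (Rat.mul_den_dvd x y)

lemma neg (hx : isPInt p x) : isPInt p (-x) := by
  simpa [isPInt] using hx

lemma sub [Fact p.Prime] (hx : isPInt p x) (hy : isPInt p y) : isPInt p (x - y) := by
  rw [sub_eq_add_neg]; exact hx.add hy.neg

lemma intCast [hp : Fact p.Prime] (z : ℤ) : isPInt p (z : ℚ) := by
  simpa [isPInt] using hp.out.ne_one

lemma natCast [Fact p.Prime] (m : ℕ) : isPInt p (m : ℚ) := mod_cast intCast (m : ℤ)

lemma one [Fact p.Prime] : isPInt p 1 := mod_cast natCast 1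

lemma zero [Fact p.Prime] : isPInt p 0 := mod_cast natCast 0

lemma inv_natCast {m : ℕ} (hm : ¬ p ∣ m) : isPInt p (m : ℚ)⁻¹ := by
  have h0 : m ≠ 0 := by rintro rfl; simp at hm
  rwa [isPInt, Rat.inv_natCast_den_of_pos (by lia)]

end isPInt

/-- A nonzero rational that is a `p`-integer together with its inverse. -/
structure IsPUnit (p : ℕ) (x : ℚ) : Prop where
  ne_zero : x ≠ 0
  isPInt : isPInt p x
  isPInt_inv : _root_.isPInt p x⁻¹

namespace IsPUnit

variable {p : ℕ} {x y : ℚ}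

lemma mul [Fact p.Prime] (hx : IsPUnit p x) (hy : IsPUnit p y) : IsPUnit p (x * y) :=
  ⟨mul_ne_zero hx.1 hy.1, hx.2.mul hy.2, by rw [mul_inv]; exact hx.3.mul hy.3⟩

lemma inv (hx : IsPUnit p x) : IsPUnit p x⁻¹ :=
  ⟨inv_ne_zero hx.1, hx.3, by rw [inv_inv]; exact hx.2⟩

lemma one [Fact p.Prime] : IsPUnit p 1 := ⟨one_ne_zero, .one, by simpa using isPInt.one⟩

lemma pow [Fact p.Prime] (hx : IsPUnit p x) (k : ℕ) : IsPUnit p (x ^ k) := by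
  induction k with
  | zero => simpa using one
  | succ k ih => rw [pow_succ]; exact ih.mul hx

lemma natCast [Fact p.Prime] {m : ℕ} (hm : ¬ p ∣ m) : IsPUnit p (m : ℚ) := by
  have h0 : m ≠ 0 := by rintro rfl; simp at hm
  exact ⟨mod_cast h0, .natCast m, .inv_natCast hm⟩

lemma natCast_of_lt [Fact p.Prime] {m : ℕ} (h0 : 0 < m) (hm : m < p) : IsPUnit p (m : ℚ) :=
  natCast (Nat.not_dvd_of_pos_of_lt h0 hm)

lemma factorial [hp : Fact p.Prime] {m : ℕ} (hm : m < p) : IsPUnit p (m ! : ℚ) :=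
  natCast (by rwa [hp.out.dvd_factorial, not_le])

lemma not_isPInt_div [hp : Fact p.Prime] (hx : IsPUnit p x) : ¬ _root_.isPInt p (x / p) := by
  intro h
  have := h.mul hx.3
  rw [div_mul_eq_mul_div, mul_inv_cancel₀ hx.1, one_div, _root_.isPInt,
    Rat.inv_natCast_den_of_pos hp.out.pos] at this
  exact this dvd_rfl

lemma of_not_isPInt_div [hp : Fact p.Prime] (hx : _root_.isPInt p x)
    (h : ¬ _root_.isPInt p (x / p)) : IsPUnit p x := by
  have hx0 : x ≠ 0 := by rintro rfl; exact h (by simpa using isPInt.zero)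
  refine ⟨hx0, hx, ?_⟩
  rw [_root_.isPInt, Rat.den_inv_of_ne_zero hx0, ← Int.natCast_dvd]
  rintro ⟨z, hz⟩
  refine h ?_
  have hp0 : (p : ℚ) ≠ 0 := mod_cast hp.out.ne_zero
  have := (isPInt.intCast (p := p) z).mul (isPInt.inv_natCast hx)
  convert this using 1
  nth_rw 1 [← Rat.num_div_den x]
  rw [hz]
  push_cast
  field_simp

end IsPUnit

/-- Congruence modulo `p ^ k` between two `p`-integers. -/
structure PIntCong (p k : ℕ) (x y : ℚ) : Prop where
  left : isPInt p x
  right : isPInt p y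
  cong : pCong p k x y

namespace PIntCong

variable {p k : ℕ} {x y z u v : ℚ}

lemma refl [Fact p.Prime] (hx : isPInt p x) : PIntCong p k x x :=
  ⟨hx, hx, by simpa [pCong] using isPInt.zero⟩

lemma symm (h : PIntCong p k x y) : PIntCong p k y x :=
  ⟨h.2, h.1, by have := h.3.neg; rwa [← neg_div, neg_sub] at this⟩

lemma trans [Fact p.Prime] (h : PIntCong p k x y) (h' : PIntCong p k y z) : PIntCong p k x z :=
  ⟨h.1, h'.2, by have := h.3.add h'.3; rwa [← add_div, sub_add_sub_cancel] at this⟩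

lemma add [Fact p.Prime] (h : PIntCong p k x y) (h' : PIntCong p k u v) :
    PIntCong p k (x + u) (y + v) :=
  ⟨h.1.add h'.1, h.2.add h'.2, by
    have := h.3.add h'.3
    rwa [← add_div, ← add_sub_add_comm] at this⟩

lemma mul [Fact p.Prime] (h : PIntCong p k x y) (h' : PIntCong p k u v) :
    PIntCong p k (x * u) (y * v) :=
  ⟨h.1.mul h'.1, h.2.mul h'.2, by
    have := (h.3.mul h'.1).add (h'.3.mul h.2)
    unfold pCong
    convert this using 1
    ring⟩

lemma inv [Fact p.Prime] (h : PIntCong p k x y) (hx : IsPUnit p x) (hy : IsPUnit p y) :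
    PIntCong p k x⁻¹ y⁻¹ :=
  ⟨hx.3, hy.3, by
    have := ((h.3.mul hx.3).mul hy.3).neg
    unfold pCong
    convert this using 1
    have := hx.1
    have := hy.1
    field_simp
    ring⟩

lemma div [Fact p.Prime] (h : PIntCong p k x y) (h' : PIntCong p k u v)
    (hu : IsPUnit p u) (hv : IsPUnit p v) : PIntCong p k (x / u) (y / v) := by
  rw [div_eq_mul_inv, div_eq_mul_inv]
  exact h.mul (h'.inv hu hv)

lemma sum [Fact p.Prime] {ι : Type*} {s : Finset ι} {f g : ι → ℚ}
    (h : ∀ i ∈ s, PIntCong p k (f i) (g i)) : PIntCong p k (∑ i ∈ s, f i) (∑ i ∈ s, g i) := by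
  classical
  induction s using Finset.induction_on with
  | empty => simpa using refl isPInt.zero
  | insert a s ha ih =>
    rw [sum_insert ha, sum_insert ha]
    exact (h a (by simp)).add (ih fun i hi => h i (by simp [hi]))

lemma prod [Fact p.Prime] {ι : Type*} {s : Finset ι} {f g : ι → ℚ}
    (h : ∀ i ∈ s, PIntCong p k (f i) (g i)) : PIntCong p k (∏ i ∈ s, f i) (∏ i ∈ s, g i) := by
  classical
  induction s using Finset.induction_on with
  | empty => simpa using refl isPInt.one
  | insert a s ha ih =>
    rw [prod_insert ha, prod_insert ha]
    exact (h a (by simp)).mul (ih fun i hi => h i (by simp [hi]))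

lemma of_sub_eq [hp : Fact p.Prime] (hx : isPInt p x) (hy : isPInt p y) (hz : isPInt p z)
    (h : x - y = p ^ k * z) : PIntCong p k x y := by
  have hp0 : (p : ℚ) ≠ 0 := mod_cast hp.out.ne_zero
  exact ⟨hx, hy, by rwa [pCong, h, mul_div_cancel_left₀ _ (pow_ne_zero _ hp0)]⟩

lemma prime_mul [hp : Fact p.Prime] (h : PIntCong p k x y) :
    PIntCong p (k + 1) (p * x) (p * y) := by
  have hp0 : (p : ℚ) ≠ 0 := mod_cast hp.out.ne_zero
  refine of_sub_eq ((isPInt.natCast p).mul h.1) ((isPInt.natCast p).mul h.2) h.3 ?_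
  field_simp
  ring

lemma isPUnit [Fact p.Prime] (h : PIntCong p 1 x y) (hy : IsPUnit p y) : IsPUnit p x := by
  refine .of_not_isPInt_div h.1 fun hx => hy.not_isPInt_div ?_
  have := hx.sub h.3
  rwa [pow_one, ← sub_div, sub_sub_cancel] at this

end PIntCong

/-! ### Factorials modulo `p` -/

lemma factorial_mul_factorial_zmod {p : ℕ} [Fact p.Prime] (a c : ℕ) (h : a + c + 1 = p) :
    ((a ! * c ! : ℕ) : ZMod p) = (-1) ^ (a + 1) := by
  induction a generalizing c with
  | zero =>
    have := ZMod.wilsons_lemma p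
    rw [show p - 1 = c by lia] at this
    simpa using this
  | succ a ih =>
    have hc := ih (c + 1) (by lia)
    have hz : ((a + 1 + c + 1 : ℕ) : ZMod p) = 0 := by rw [h]; simp
    rw [Nat.factorial_succ] at hc ⊢
    push_cast at hc hz ⊢
    linear_combination -hc + (a ! * c ! : ZMod p) * hz

lemma PIntCong.of_zmod {p : ℕ} [Fact p.Prime] {x y : ℤ} (h : (x : ZMod p) = y) :
    PIntCong p 1 (x : ℚ) (y : ℚ) := by
  obtain ⟨z, hz⟩ := (ZMod.intCast_eq_intCast_iff_dvd_sub y x p).1 h.symm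
  refine .of_sub_eq (.intCast x) (.intCast y) (.intCast z) ?_
  rw [pow_one]
  exact_mod_cast hz

lemma factorial_mul_factorial_cong {p : ℕ} [Fact p.Prime] (a c : ℕ) (h : a + c + 1 = p) :
    PIntCong p 1 ((a ! : ℚ) * c !) ((-1) ^ (a + 1)) := by
  have := PIntCong.of_zmod (p := p) (x := (a ! * c ! : ℕ)) (y := (-1) ^ (a + 1))
    (by simpa using factorial_mul_factorial_zmod a c h)
  simpa using this

lemma prod_range_sub_eq_factorial (n : ℕ) : ∏ j ∈ range n, ((n : ℚ) - j) = n ! := by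
  induction n with
  | zero => simp
  | succ n ih =>
    rw [prod_range_succ', Nat.factorial_succ]
    push_cast
    simp only [add_sub_add_right_eq_sub, ih]
    ring

lemma prod_range_add_one_eq_factorial_cast (n : ℕ) : ∏ j ∈ range n, ((j : ℚ) + 1) = n ! := by
  exact_mod_cast prod_range_add_one_eq_factorial n

lemma factorial_mul_prod_range (a n : ℕ) :
    (a ! : ℚ) * ∏ j ∈ range n, ((a : ℚ) + 1 + j) = (a + n)! := by
  induction n with
  | zero => simp
  | succ n ih =>
    rw [prod_range_succ, ← mul_assoc, ih, ← add_assoc, Nat.factorial_succ]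
    push_cast
    ring

/-! ### A partial fraction identity -/

/-- The coefficient `(-1) ^ k * C(n, k) * C(n + k, k)` of the shifted Legendre polynomial. -/
def legendreCoeff (n k : ℕ) : ℚ :=
  ∏ j ∈ range k, -(((n : ℚ) - j) * (n + 1 + j)) / (j + 1) ^ 2

/-- Half the sum of `legendreCoeff (N - 1) k` and `legendreCoeff N k`. -/
def legendreMean (N k : ℕ) : ℚ :=
  ∏ j ∈ range k, -(((N : ℚ) - j) * (N + j)) / (j + 1) ^ 2

lemma legendreCoeff_eq_zero {n k : ℕ} (h : n < k) : legendreCoeff n k = 0 :=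
  prod_eq_zero (mem_range.2 h) (by simp)

lemma legendreMean_eq_zero {N k : ℕ} (h : N < k) : legendreMean N k = 0 :=
  prod_eq_zero (mem_range.2 h) (by simp)

lemma legendreCoeff_eq_mean (N k : ℕ) (hN : N ≠ 0) :
    legendreCoeff N k = legendreMean N k * (N + k) / N := by
  have hN' : (N : ℚ) ≠ 0 := mod_cast hN
  induction k with
  | zero => simp [legendreCoeff, legendreMean, hN']
  | succ k ih =>
    rw [legendreCoeff, legendreMean, prod_range_succ, prod_range_succ, ← legendreCoeff,
      ← legendreMean, ih]
    push_cast
    field_simp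
    ring

lemma legendreCoeff_pred_eq_mean (n k : ℕ) :
    legendreCoeff n k = legendreMean (n + 1) k * (n + 1 - k) / (n + 1) := by
  induction k with
  | zero => simp [legendreCoeff, legendreMean, Nat.cast_add_one_ne_zero]
  | succ k ih =>
    rw [legendreCoeff, legendreMean, prod_range_succ, prod_range_succ, ← legendreCoeff,
      ← legendreMean, ih]
    push_cast
    field_simp
    ring

lemma sum_legendreMean (N m : ℕ) (hN : N ≠ 0) :
    ∑ k ∈ range m, legendreMean N k = -(m ^ 2 / N ^ 2) * legendreMean N m := by
  have hN' : (N : ℚ) ≠ 0 := mod_cast hN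
  induction m with
  | zero => simp
  | succ m ih =>
    rw [sum_range_succ, ih, legendreMean, legendreMean, prod_range_succ]
    push_cast
    field_simp
    ring

lemma sum_legendreCoeff_div (n : ℕ) (x : ℚ) (hx : ∀ k ≤ n, (k : ℚ) + x ≠ 0) :
    ∑ k ∈ range (n + 1), legendreCoeff n k / (k + x) =
      (∏ j ∈ range n, ((j : ℚ) + 1 - x)) / ∏ j ∈ range (n + 1), ((j : ℚ) + x) := by
  induction n with
  | zero => simp [legendreCoeff]
  | succ n ih =>
    have hn := ih fun k hk => hx k (by lia)
    have hx' := hx (n + 1) le_rfl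
    have hsum := sum_legendreMean (n + 1) (n + 2) (by lia)
    rw [legendreMean_eq_zero (by lia), mul_zero] at hsum
    have hext : ∑ k ∈ range (n + 1), legendreCoeff n k / (k + x) =
        ∑ k ∈ range (n + 2), legendreCoeff n k / (k + x) := by
      rw [sum_range_succ _ (n + 1), legendreCoeff_eq_zero (by lia)]
      simp
    have hrec : (((n + 1 : ℕ) : ℚ) + x) *
          ∑ k ∈ range (n + 2), legendreCoeff (n + 1) k / (k + x) -
        (n + 1 - x) * ∑ k ∈ range (n + 2), legendreCoeff n k / (k + x) = 0 := by
      rw [mul_sum, mul_sum, ← sum_sub_distrib, ← mul_zero (2 : ℚ), ← hsum, mul_sum]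
      refine sum_congr rfl fun k hk => ?_
      have hk := hx k (by simp at hk; lia)
      rw [legendreCoeff_eq_mean (n + 1) k (by lia), legendreCoeff_pred_eq_mean]
      push_cast
      field_simp
      ring
    rw [← hext, hn] at hrec
    rw [prod_range_succ, prod_range_succ _ (n + 1), mul_div_mul_comm]
    rw [← mul_div_assoc, eq_div_iff hx']
    linear_combination hrec

/-! ### Central binomial coefficients -/

lemma choose_two_mul_eq_prod (k : ℕ) :
    ((2 * k).choose k : ℚ) = 4 ^ k * ∏ j ∈ range k, ((2 * j + 1 : ℚ) / (2 * (j + 1))) := by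
  rw [← Nat.centralBinom_eq_two_mul_choose]
  induction k with
  | zero => simp
  | succ k ih =>
    have h : ((k + 1 : ℕ) : ℚ) * (k + 1).centralBinom = 2 * (2 * k + 1) * k.centralBinom :=
      mod_cast Nat.succ_mul_centralBinom_succ k
    rw [prod_range_succ, pow_succ]
    rw [ih] at h
    push_cast at h
    have hk : (k : ℚ) + 1 ≠ 0 := Nat.cast_add_one_ne_zero k
    rw [← mul_right_inj' hk, h]
    field_simp
    ring

lemma prod_sq_cong_legendreCoeff {p n k : ℕ} [Fact p.Prime] (hn : p = 2 * n + 1) (hk : k < p) :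
    PIntCong p 2 ((∏ j ∈ range k, ((2 * j + 1 : ℚ) / (2 * (j + 1)))) ^ 2)
      (legendreCoeff n k) := by
  have h2 : IsPUnit p (2 : ℚ) := mod_cast IsPUnit.natCast_of_lt (p := p) (m := 2) (by lia)
    (by have := (Fact.out : p.Prime).two_le; lia)
  rw [← prod_pow, legendreCoeff]
  refine .prod fun j hj => ?_
  have hj1 : IsPUnit p ((j : ℚ) + 1) := mod_cast IsPUnit.natCast_of_lt (p := p) (m := j + 1)
    (by lia) (by simp at hj; lia)
  have e1 : ((2 * j + 1 : ℚ) / (2 * (j + 1))) ^ 2 =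
      (((2 * j + 1) ^ 2 : ℤ) : ℚ) * ((2 * ((j : ℚ) + 1)) ^ 2)⁻¹ := by
    push_cast
    rw [div_pow, div_eq_mul_inv]
  have e2 : -(((n : ℚ) - j) * (n + 1 + j)) / (j + 1) ^ 2 =
      ((-((n - j) * (n + 1 + j)) : ℤ) : ℚ) * (((j : ℚ) + 1) ^ 2)⁻¹ := by
    push_cast
    rw [div_eq_mul_inv]
  rw [e1, e2]
  have hu := ((h2.mul hj1).pow 2).inv
  refine .of_sub_eq ((isPInt.intCast _).mul hu.2) ((isPInt.intCast _).mul (hj1.pow 2).inv.2) hu.2 ?_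
  have := hj1.1
  rw [hn]
  push_cast
  field_simp
  ring

/-- The factor `p / 2` of the product defining `C(2m, m) / 4 ^ m`, for `p = 2n + 1` and
`m = n + 1 + r`, is split off. -/
lemma prod_odd_div_even_cong {p n r B : ℕ} [Fact p.Prime] (hn : p = 2 * n + 1)
    (hr : n = B + 1 + r) :
    ∃ z : ℚ, ∏ j ∈ range (n + 1 + r), ((2 * j + 1 : ℚ) / (2 * (j + 1))) = p * z ∧
      PIntCong p 1 (z ^ 2) ((-1) ^ (n + 1) * (B ! * r ! : ℚ) ^ 2 / 4) := by
  have h2 : IsPUnit p (2 : ℚ) := mod_cast IsPUnit.natCast_of_lt (p := p) (m := 2) (by lia)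
    (by lia)
  have h4 : IsPUnit p (4 : ℚ) := by convert h2.pow 2; norm_num
  have half (j : ℕ) : isPInt p ((2 * j + 1 : ℚ) / 2) := by
    rw [div_eq_mul_inv]
    exact mod_cast (isPInt.natCast (p := p) (2 * j + 1)).mul h2.3
  set P₁ := ∏ j ∈ range n, ((2 * j + 1 : ℚ) / 2)
  set P₂ := ∏ j ∈ range r, ((2 * (n + 1 + j : ℕ) + 1 : ℚ) / 2)
  have hm : IsPUnit p ((n + 1 + r)! : ℚ) := .factorial (by lia)
  have hP₁ : PIntCong p 1 P₁ ((-1) ^ n * n !) := by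
    rw [← prod_range_sub_eq_factorial, ← card_range n, ← prod_const, card_range,
      ← prod_mul_distrib]
    refine .prod fun j _ => .of_sub_eq (half j) ?_ h2.3 ?_
    · exact mod_cast isPInt.intCast (p := p) (-1 * (n - j))
    · rw [hn]
      push_cast
      ring
  have hP₂ : PIntCong p 1 P₂ (r ! : ℚ) := by
    rw [← prod_range_add_one_eq_factorial_cast]
    refine .prod fun j _ => .of_sub_eq (half _) ?_ h2.3 ?_
    · exact mod_cast isPInt.natCast (p := p) (j + 1)
    · rw [hn]
      push_cast
      ring
  have hz := (hP₁.mul hP₂).div (.refl (h2.mul hm).2) (h2.mul hm) (h2.mul hm)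
  refine ⟨P₁ * P₂ / (2 * (n + 1 + r)!), ?_, ?_⟩
  · rw [← prod_range_add_one_eq_factorial_cast]
    have hne : ∏ j ∈ range (n + 1 + r), ((j : ℚ) + 1) ≠ 0 := by
      rw [prod_range_add_one_eq_factorial_cast]; exact hm.1
    have : ∏ j ∈ range (n + 1 + r), ((2 * j + 1 : ℚ) / (2 * (j + 1))) =
        (∏ j ∈ range (n + 1 + r), ((2 * j + 1 : ℚ) / 2)) /
          ∏ j ∈ range (n + 1 + r), ((j : ℚ) + 1) := by
      rw [← prod_div_distrib]
      exact prod_congr rfl fun j _ => (div_div _ _ _).symm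
    rw [this, prod_range_add, prod_range_succ, hn]
    push_cast
    field_simp
    simp only [P₁, P₂]
    push_cast
    ring
  · have hnn := factorial_mul_factorial_cong (p := p) n n (by lia)
    have hBm := factorial_mul_factorial_cong (p := p) B (n + 1 + r) (by lia)
    have hsq : ((-1 : ℚ) ^ (B + 1)) * (-1) ^ (B + 1) = 1 := by rw [← mul_pow]; norm_num
    have hB : IsPUnit p (B ! : ℚ) := .factorial (by lia)
    have hBm' := hBm.mul hBm
    rw [hsq] at hBm'
    have key := (hnn.div hBm' (.mul (.mul hB hm) (.mul hB hm)) .one).mul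
      (.refl (((hB.mul (.factorial (p := p) (m := r) (by lia))).pow 2).mul h4.inv).2)
    rw [sq]
    refine (hz.mul hz).trans ?_
    convert key using 1
    · have hsq' : ((-1 : ℚ) ^ n) * (-1) ^ n = 1 := by rw [← mul_pow]; norm_num
      have := hm.1
      have := hB.1
      field_simp
      linear_combination (4 : ℚ) * hsq'
    · ring

/-- For `p = 2n + 1` and `b = B + 1 + p * s` with `B < n`, the closed form of
`sum_legendreCoeff_div` at `b` is `p * s` times an explicit residue. -/
lemma prod_div_prod_cong {p n r B : ℕ} [Fact p.Prime] {b s : ℚ} (hn : p = 2 * n + 1)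
    (hr : n = B + 1 + r) (hs : isPInt p s) (hb : b = B + 1 + p * s) :
    ∃ w : ℚ, (∏ j ∈ range n, ((j : ℚ) + 1 - b)) / ∏ j ∈ range (n + 1), ((j : ℚ) + b) =
        p * (s * w) ∧ PIntCong p 1 w ((-1) ^ (n + 1) * (B ! * r ! : ℚ) ^ 2) := by
  have hbc : PIntCong p 1 b ((B : ℚ) + 1) := by
    refine .of_sub_eq ?_ (mod_cast .natCast (B + 1)) hs (by rw [hb]; ring)
    rw [hb]
    exact (mod_cast isPInt.natCast (B + 1) : isPInt p ((B : ℚ) + 1)).add ((isPInt.natCast p).mul hs)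
  have hsub {x : ℚ} (hx : isPInt p x) : PIntCong p 1 (x - b) (x - (B + 1)) := by
    refine .of_sub_eq (hx.sub hbc.1) (hx.sub hbc.2) hs.neg (by rw [hb]; ring)
  set A := ∏ j ∈ range B, ((j : ℚ) + 1 - b)
  set D := ∏ j ∈ range r, (((B + 1 + j : ℕ) : ℚ) + 1 - b)
  set G := ∏ j ∈ range (n + 1), ((j : ℚ) + b)
  have hA : PIntCong p 1 A ((-1) ^ B * B !) := by
    rw [← prod_range_sub_eq_factorial, ← card_range B, ← prod_const, card_range,
      ← prod_mul_distrib]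
    refine .prod fun j _ => ?_
    convert hsub (mod_cast isPInt.natCast (j + 1) : isPInt p ((j : ℚ) + 1)) using 1
    ring
  have hD : PIntCong p 1 D (r ! : ℚ) := by
    rw [← prod_range_add_one_eq_factorial_cast]
    refine .prod fun j _ => ?_
    convert hsub (mod_cast isPInt.natCast (B + 1 + j + 1) :
      isPInt p (((B + 1 + j : ℕ) : ℚ) + 1)) using 1
    push_cast
    ring
  have hB : IsPUnit p (B ! : ℚ) := .factorial (by lia)
  have hru : IsPUnit p (r ! : ℚ) := .factorial (by lia)
  have hG : PIntCong p 1 G (∏ j ∈ range (n + 1), ((B : ℚ) + 1 + j)) := by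
    refine .prod fun j _ => ?_
    convert (PIntCong.refl (isPInt.natCast j)).add hbc using 1
    ring
  have hGB := factorial_mul_prod_range B (n + 1)
  have hfac : PIntCong p 1 (((B + (n + 1))! : ℚ) * r !) ((-1) ^ (B + (n + 1) + 1)) :=
    factorial_mul_factorial_cong _ _ (by lia)
  have hsgn : IsPUnit p ((-1 : ℚ) ^ (B + (n + 1) + 1)) :=
    IsPUnit.pow ⟨by norm_num, IsPUnit.one.2.neg, by
      rw [inv_neg_one]; exact IsPUnit.one.2.neg⟩ _
  have hG' : PIntCong p 1 G ((-1) ^ (B + (n + 1) + 1) / (B ! * r !)) := by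
    refine hG.trans ?_
    have hu := hB.mul hru
    convert hfac.div (.refl hu.2) hu hu using 1
    rw [← hGB]
    have := hB.1
    have := hru.1
    field_simp
  have hVu : IsPUnit p ((-1 : ℚ) ^ (B + (n + 1) + 1) / (B ! * r !)) := by
    rw [div_eq_mul_inv]
    exact hsgn.mul (hB.mul hru).inv
  have hGu := hG'.isPUnit hVu
  refine ⟨-1 * (A * D / G), ?_, ?_⟩
  · rw [hr, prod_range_add, prod_range_succ]
    simp only [A, D]
    rw [hb]
    push_cast
    ring
  · have key := (PIntCong.refl (IsPUnit.one (p := p)).2.neg).mul ((hA.mul hD).div hG' hGu hVu)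
    convert key using 1
    have := hB.1
    have := hru.1
    rcases neg_one_pow_eq_or ℚ B with h | h <;> rcases neg_one_pow_eq_or ℚ n with h' | h' <;>
    · simp only [pow_add, pow_one, h, h']
      field_simp

/-! ### The congruence -/

lemma sum_choose_sq_cong {p n c r : ℕ} [Fact p.Prime] {b s : ℚ} (hn : p = 2 * n + 1)
    (hr : n = c + 1 + r) (hs : isPInt p s) (hb : b = c + 1 + p * s)
    (hs1 : IsPUnit p (s + 1)) :
    PIntCong p 2
      (∑ k ∈ range p, ((2 * k).choose k : ℚ) ^ 2 / (16 ^ k * ((k : ℚ) + b)))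
      ((p : ℚ) * (s + 1 / 2) ^ 2 / (b ^ 2 * (s + 1) * (n.choose (c + 1) : ℚ) ^ 2)) := by
  have hp0 : (p : ℚ) ≠ 0 := mod_cast (Fact.out : p.Prime).ne_zero
  have hbI : isPInt p b := by
    rw [hb]
    exact (mod_cast isPInt.natCast (c + 1) : isPInt p ((c : ℚ) + 1)).add ((isPInt.natCast p).mul hs)
  have hkb (k : ℕ) (hk : k < p) (hkm : k ≠ n + 1 + r) : IsPUnit p ((k : ℚ) + b) := by
    have hu : IsPUnit p ((k + c + 1 : ℕ) : ℚ) := by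
      refine .natCast fun ⟨q, hq⟩ => ?_
      have h1 : q < 2 := by
        by_contra! h
        have := Nat.mul_le_mul_left p h
        lia
      interval_cases q <;> lia
    refine PIntCong.isPUnit (.of_sub_eq ((isPInt.natCast k).add hbI) hu.2 hs ?_) hu
    rw [hb]
    push_cast
    ring
  obtain ⟨z, hz, hzc⟩ := prod_odd_div_even_cong hn hr
  obtain ⟨w, hw, hwc⟩ := prod_div_prod_cong hn hr hs hb
  rw [← sum_legendreCoeff_div n b fun k hk => (hkb k (by lia) (by lia)).1] at hw
  set V : ℚ := (-1) ^ (n + 1) * (c ! * r ! : ℚ) ^ 2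
  set a : ℕ → ℚ := fun k => ∏ j ∈ range k, ((2 * j + 1 : ℚ) / (2 * (j + 1)))
  have hterm (k : ℕ) : ((2 * k).choose k : ℚ) ^ 2 / (16 ^ k * ((k : ℚ) + b)) =
      a k ^ 2 / (k + b) := by
    rw [choose_two_mul_eq_prod, mul_pow, ← pow_mul, mul_comm k, pow_mul, ← div_div]
    rw [show (4 : ℚ) ^ 2 = 16 by norm_num, mul_div_cancel_left₀ _ (by positivity)]
  have hmem : n + 1 + r ∈ range p := by simp; lia
  have hsumL : ∑ k ∈ range p, ((2 * k).choose k : ℚ) ^ 2 / (16 ^ k * ((k : ℚ) + b)) =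
      ∑ k ∈ (range p).erase (n + 1 + r), a k ^ 2 / (k + b) + p * (z ^ 2 / (s + 1)) := by
    rw [sum_congr rfl fun k _ => hterm k, ← sum_erase_add _ _ hmem]
    congr 1
    have hpm : ((n + 1 + r : ℕ) : ℚ) + b = p * (s + 1) := by
      rw [hb, hn, hr]
      push_cast
      ring
    have := hs1.1
    simp only [a, hz, hpm]
    field_simp
  have hsumR : ∑ k ∈ (range p).erase (n + 1 + r), legendreCoeff n k / (k + b) = p * (s * w) := by
    rw [← hw]
    refine (sum_subset (fun k hk => ?_) fun k hk hk' => ?_).symm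
    · simp at hk ⊢; lia
    · rw [legendreCoeff_eq_zero (by simpa using hk'), zero_div]
  have hcong : PIntCong p 2 (∑ k ∈ (range p).erase (n + 1 + r), a k ^ 2 / (k + b))
      (p * (s * w)) := by
    rw [← hsumR]
    refine .sum fun k hk => ?_
    simp only [mem_erase, mem_range] at hk
    have hu := hkb k hk.2 hk.1
    exact (prod_sq_cong_legendreCoeff hn hk.2).div (.refl hu.2) hu hu
  have hcb : PIntCong p 1 ((c : ℚ) + 1) b :=
    .of_sub_eq (mod_cast .natCast (c + 1)) hbI hs.neg (by rw [hb]; ring)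
  have hbu : IsPUnit p b := by simpa using hkb 0 (by lia) (by lia)
  have hcu : IsPUnit p ((c : ℚ) + 1) := hcb.isPUnit hbu
  have hcr : isPInt p ((c ! * r ! : ℚ) ^ 2) := mod_cast .natCast ((c ! * r !) ^ 2)
  have hnn : PIntCong p 1 ((-1) ^ (n + 1)) ((n ! : ℚ) * n !) :=
    (factorial_mul_factorial_cong (p := p) n n (by lia)).symm
  have hnu : IsPUnit p (n ! : ℚ) := .factorial (by lia)
  have h2 : IsPUnit p (2 : ℚ) := mod_cast IsPUnit.natCast_of_lt (p := p) (m := 2) (by lia)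
    (by lia)
  have hleft := hcong.add ((hzc.div (.refl hs1.2) hs1 hs1).prime_mul)
  have hV : PIntCong p 1 V ((c + 1) * (c + 1) * (c ! * r ! : ℚ) ^ 2 / (b * b * (n ! * n !))) := by
    have hbb := hbu.mul hbu
    have hnn' := hnu.mul hnu
    have key := ((hcb.symm.mul hcb.symm).div (.refl hbb.2) hbb hbb).mul
      ((hnn.inv (hnn.isPUnit hnn') hnn').mul (.refl hcr))
    convert key using 1
    · rw [div_self hbb.1, one_mul, ← inv_pow, inv_neg_one]
    · ring
  have hmid := ((PIntCong.refl hs).mul (hwc.trans hV)).prime_mul.add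
    ((hV.div (.refl (h2.pow 2).2) (h2.pow 2) (h2.pow 2)).div (.refl hs1.2) hs1 hs1).prime_mul
  rw [hsumL]
  have e4 : V / 4 = V / 2 ^ 2 := by norm_num
  rw [e4] at hleft
  convert hleft.trans hmid using 1
  have hchoose : (n.choose (c + 1) : ℚ) * ((c + 1) * c !) * r ! = n ! := by
    have := Nat.choose_mul_factorial_mul_factorial (show c + 1 ≤ n by lia)
    rw [show n - (c + 1) = r by lia, Nat.factorial_succ] at this
    exact_mod_cast this
  have hC : (n.choose (c + 1) : ℚ) ≠ 0 := mod_cast (Nat.choose_pos (by lia)).ne'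
  have := hbu.1
  have := hs1.1
  have := hcu.1
  have : (c ! : ℚ) ≠ 0 := mod_cast c.factorial_ne_zero
  have : (r ! : ℚ) ≠ 0 := mod_cast r.factorial_ne_zero
  rw [← hchoose]
  field_simp
  ring

end Auxiliary

theorem stmt3 (p : ℕ) (hp : p.Prime) (hp3 : 3 < p) (b : ℚ) (B : ℕ)
    (hb : isPInt p b) (hB : B < p) (hbB : pCong p 1 b (B : ℚ))
    (hB0 : B ≠ 0) (hBlt : 2 * B < p)
    (hs : ¬ pCong p 1 ((b - B) / p) (-1)) :
    pCong p 2
      (∑ k ∈ Finset.range p, ((2 * k).choose k : ℚ) ^ 2 / (16 ^ k * ((k : ℚ) + b)))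
      ((p : ℚ) * (((b - B) / p) + 1 / 2) ^ 2 /
        (b ^ 2 * (((b - B) / p) + 1) * (((p - 1) / 2).choose B : ℚ) ^ 2)) := by
  have : Fact p.Prime := ⟨hp⟩
  have hp0 : (p : ℚ) ≠ 0 := mod_cast hp.ne_zero
  obtain ⟨n, hn⟩ : ∃ n, p = 2 * n + 1 := hp.odd_of_ne_two (by lia)
  obtain ⟨c, rfl⟩ := Nat.exists_eq_succ_of_ne_zero hB0
  obtain ⟨r, hr⟩ : ∃ r, n = c + 1 + r := Nat.exists_eq_add_of_le (by lia)
  have hhalf : (p - 1) / 2 = n := by lia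
  rw [hhalf]
  rw [Nat.succ_eq_add_one] at *
  generalize hsdef : (b - (c + 1 : ℕ)) / (p : ℚ) = s at *
  have hsI : isPInt p s := by simpa only [pCong, hsdef, pow_one] using hbB
  have hb' : b = c + 1 + p * s := by
    rw [← hsdef]
    push_cast
    field_simp
    ring
  exact (sum_choose_sq_cong hn hr hsI hb'
    (.of_not_isPInt_div (hsI.add .one) (by simpa [pCong] using hs))).cong
end
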